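/- arXiv:2105.02323 — 6 statements merged into one kernel-verified Lean document; each statement's English description precedes it below -/
import Mathlib

section
/- Let n ≥ 2 be an integer, let κ > 0 and z > 0 be real, and set E = −κ²/(4z²). Then the function u(r) = M((n−1)/2 − z, n−1; 2√|E|·r)·e^{−√|E|·r} is twice differentiable on (0,∞) and satisfies −u''(r) − ((n−1)/r)·u'(r) − (κ/r)·u(r) = E·u(r) for every r > 0. -/
open Real

/-- The rising factorial (Pochhammer symbol) `(a)_k = a (a+1) ⋯ (a+k-1)`, with `(a)_0 = 1`. -/
noncomputable def risingFactorial (a : ℝ) (k : ℕ) : ℝ :=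
  ∏ i ∈ Finset.range k, (a + i)

/-- The confluent hypergeometric function of the first kind,
`M(a,b;ρ) = ∑_{k=0}^∞ ((a)_k/(b)_k) ρ^k/k!`. -/
noncomputable def CHF_M (a b ρ : ℝ) : ℝ :=
  ∑' k : ℕ, risingFactorial a k / risingFactorial b k * ρ ^ k / (Nat.factorial k : ℝ)

/-- A real power series whose coefficients are `O(K ^ k / k!)` converges everywhere. -/
theorem summable_mul_pow_of_abs_le {c : ℕ → ℝ} {C K : ℝ}
    (hc : ∀ k, |c k| ≤ C * K ^ k / (Nat.factorial k : ℝ)) (x : ℝ) :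
    Summable fun k => c k * x ^ k := by
  refine .of_norm_bounded ((Real.summable_pow_div_factorial (K * |x|)).mul_left C) fun k => ?_
  rw [Real.norm_eq_abs, abs_mul, abs_pow]
  calc |c k| * |x| ^ k ≤ C * K ^ k / (Nat.factorial k : ℝ) * |x| ^ k := by
        gcongr
        exact hc k
    _ = C * ((K * |x|) ^ k / (Nat.factorial k : ℝ)) := by
        rw [mul_pow]
        ring

/-- The coefficient bound `O(K ^ k / k!)` is inherited by the differentiated series. -/
theorem abs_succ_mul_le_of_abs_le {c : ℕ → ℝ} {C K : ℝ}
    (hc : ∀ k, |c k| ≤ C * K ^ k / (Nat.factorial k : ℝ)) (k : ℕ) :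
    |((k : ℝ) + 1) * c (k + 1)| ≤ C * K * K ^ k / (Nat.factorial k : ℝ) := by
  have hk : (0 : ℝ) < k + 1 := by positivity
  rw [abs_mul, abs_of_pos hk]
  calc ((k : ℝ) + 1) * |c (k + 1)|
      ≤ (k + 1) * (C * K ^ (k + 1) / (Nat.factorial (k + 1) : ℝ)) := by
        gcongr
        exact hc (k + 1)
    _ = C * K * K ^ k / (Nat.factorial k : ℝ) := by
        rw [Nat.factorial_succ]
        push_cast
        field_simp
        ring

/-- Termwise differentiation of a power series with coefficients `O(K ^ k / k!)`. -/
theorem hasDerivAt_tsum_mul_pow_of_abs_le {c : ℕ → ℝ} {C K : ℝ}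
    (hc : ∀ k, |c k| ≤ C * K ^ k / (Nat.factorial k : ℝ)) (x : ℝ) :
    HasDerivAt (fun y => ∑' k, c k * y ^ k) (∑' k : ℕ, ((k : ℝ) + 1) * c (k + 1) * x ^ k) x := by
  have hd := abs_succ_mul_le_of_abs_le hc
  set R : ℝ := |x| + 1 with hR
  have hR0 : 0 < R := by positivity
  have hx : x ∈ Metric.ball (0 : ℝ) R := by simp [hR]
  have hbound : Summable fun k : ℕ => |c k * (k * R ^ (k - 1))| := by
    rw [← summable_nat_add_iff 1]
    refine (summable_mul_pow_of_abs_le hd R).abs.congr fun k => ?_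
    congr 1
    simp only [Nat.add_sub_cancel_right]
    push_cast
    ring
  have key := hasDerivAt_tsum_of_isPreconnected (g := fun k y => c k * y ^ k)
    (g' := fun k y => c k * (k * y ^ (k - 1))) hbound Metric.isOpen_ball
    (convex_ball (0 : ℝ) R).isPreconnected
    (fun k y _ => (hasDerivAt_pow k y).const_mul (c k))
    (fun k y hy => by
      have hy' : |y| ≤ |R| := by
        rw [abs_of_pos hR0]
        simpa using (mem_ball_zero_iff.mp hy).le
      simp only [Real.norm_eq_abs, abs_mul, abs_pow]
      gcongr)
    hx (summable_mul_pow_of_abs_le hc x) hx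
  refine key.congr_deriv ?_
  have hs := (hasSum_nat_add_iff (f := fun k : ℕ => c k * ((k : ℝ) * x ^ (k - 1))) 1
    (g := ∑' k : ℕ, ((k : ℝ) + 1) * c (k + 1) * x ^ k)).mp
      ((summable_mul_pow_of_abs_le hd x).hasSum.congr_fun fun k => by
        simp only [Nat.add_sub_cancel_right]
        push_cast
        ring)
  simpa using hs.tsum_eq

/-- The Euler operator `x d/dx` multiplies the `k`-th coefficient of a power series by `k`. -/
theorem hasSum_natCast_mul_mul_pow_of_abs_le {c : ℕ → ℝ} {C K : ℝ}
    (hc : ∀ k, |c k| ≤ C * K ^ k / (Nat.factorial k : ℝ)) (x : ℝ) :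
    HasSum (fun k : ℕ => (k : ℝ) * c k * x ^ k)
      (x * ∑' k : ℕ, ((k : ℝ) + 1) * c (k + 1) * x ^ k) := by
  have hs := (hasSum_nat_add_iff (f := fun k : ℕ => (k : ℝ) * c k * x ^ k) 1
    (g := x * ∑' k : ℕ, ((k : ℝ) + 1) * c (k + 1) * x ^ k)).mp
      (((summable_mul_pow_of_abs_le
        (abs_succ_mul_le_of_abs_le hc) x).hasSum.mul_left x).congr_fun fun k => by
        push_cast
        ring)
  simpa using hs

/-- For `b > 0` the ratio of rising factorials grows at most geometrically. -/
theorem abs_risingFactorial_div_le (a : ℝ) {b : ℝ} (hb : 0 < b) (k : ℕ) :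
    |risingFactorial a k / risingFactorial b k| ≤ (|a| / b + 1) ^ k := by
  unfold risingFactorial
  rw [← Finset.prod_div_distrib, Finset.abs_prod]
  refine (Finset.prod_le_prod (g := fun _ => |a| / b + 1) (fun i _ => abs_nonneg _)
    fun i _ => ?_).trans_eq (by simp)
  have hbi : 0 < b + i := by positivity
  rw [abs_div, abs_of_pos hbi, div_le_iff₀ hbi]
  have h1 : |a + i| ≤ |a| + i := (abs_add_le _ _).trans_eq (by simp)
  have h2 : (|a| / b + 1) * (b + i) = |a| + i + (b + |a| / b * i) := by
    field_simp
    ring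
  have h3 : 0 ≤ b + |a| / b * i := by positivity
  linarith

/-- For `b > 0` the function `M(a,b;·)` is twice differentiable and solves Kummer's equation
`x · d²M/dx² + (b - x) · dM/dx - a · M = 0`. -/
theorem exists_hasDerivAt_CHF_M_kummer (a : ℝ) {b : ℝ} (hb : 0 < b) :
    ∃ dM d2M : ℝ → ℝ, (∀ x, HasDerivAt (CHF_M a b) (dM x) x) ∧
      (∀ x, HasDerivAt dM (d2M x) x) ∧
      ∀ x, x * d2M x + (b - x) * dM x - a * CHF_M a b x = 0 := by
  set c : ℕ → ℝ := fun k => risingFactorial a k / risingFactorial b k / (Nat.factorial k : ℝ)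
    with hc_def
  have hM : CHF_M a b = fun x => ∑' k, c k * x ^ k := by
    funext x
    unfold CHF_M
    congr 1
    funext k
    simp only [hc_def]
    ring
  have hc : ∀ k, |c k| ≤ 1 * (|a| / b + 1) ^ k / (Nat.factorial k : ℝ) := fun k => by
    rw [one_mul, abs_div, Nat.abs_cast]
    gcongr
    exact abs_risingFactorial_div_le a hb k
  have hd := abs_succ_mul_le_of_abs_le hc
  have hrec : ∀ k : ℕ, (b + k) * ((k + 1) * c (k + 1)) = (a + k) * c k := fun k => by
    have hbk : b + k ≠ 0 := by positivity
    have hbf : risingFactorial b k ≠ 0 :=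
      Finset.prod_ne_zero_iff.mpr fun i _ => by positivity
    have ha : risingFactorial a (k + 1) = risingFactorial a k * (a + k) :=
      Finset.prod_range_succ _ _
    have hb' : risingFactorial b (k + 1) = risingFactorial b k * (b + k) :=
      Finset.prod_range_succ _ _
    simp only [hc_def]
    rw [ha, hb', Nat.factorial_succ]
    push_cast
    field_simp
  refine ⟨_, _, fun x => hM ▸ hasDerivAt_tsum_mul_pow_of_abs_le hc x,
    fun x => hasDerivAt_tsum_mul_pow_of_abs_le hd x, fun x => ?_⟩
  have hsum := (((hasSum_natCast_mul_mul_pow_of_abs_le hd x).add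
    ((summable_mul_pow_of_abs_le hd x).hasSum.mul_left b)).sub
    (hasSum_natCast_mul_mul_pow_of_abs_le hc x)).sub
    ((summable_mul_pow_of_abs_le hc x).hasSum.mul_left a)
  have hzero := hsum.unique (hasSum_zero.congr_fun fun k => by
    linear_combination x ^ k * hrec k)
  rw [hM]
  linear_combination hzero

/-- Let `n ≥ 2`, `κ > 0`, `z > 0`, and `E = −κ²/(4z²)`.  Then
`u(r) = M((n−1)/2 − z, n−1; 2√|E| r) e^{−√|E| r}` is twice differentiable on `(0,∞)` and
satisfies `−u'' − ((n−1)/r) u' − (κ/r) u = E u` for every `r > 0`. -/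
theorem chf_radial_eigenfunction (n : ℕ) (hn : 2 ≤ n) (κ z : ℝ) (hκ : 0 < κ) (hz : 0 < z)
    (E : ℝ) (hE : E = -κ ^ 2 / (4 * z ^ 2)) :
    (∀ r : ℝ, 0 < r → DifferentiableAt ℝ
      (fun s : ℝ => CHF_M (((n : ℝ) - 1) / 2 - z) ((n : ℝ) - 1) (2 * Real.sqrt |E| * s)
        * Real.exp (-(Real.sqrt |E|) * s)) r) ∧
    (∀ r : ℝ, 0 < r → DifferentiableAt ℝ
      (deriv (fun s : ℝ => CHF_M (((n : ℝ) - 1) / 2 - z) ((n : ℝ) - 1) (2 * Real.sqrt |E| * s)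
        * Real.exp (-(Real.sqrt |E|) * s))) r) ∧
    (∀ r : ℝ, 0 < r →
      -(deriv (deriv (fun s : ℝ =>
          CHF_M (((n : ℝ) - 1) / 2 - z) ((n : ℝ) - 1) (2 * Real.sqrt |E| * s)
            * Real.exp (-(Real.sqrt |E|) * s))) r)
        - (((n : ℝ) - 1) / r) * deriv (fun s : ℝ =>
          CHF_M (((n : ℝ) - 1) / 2 - z) ((n : ℝ) - 1) (2 * Real.sqrt |E| * s)
            * Real.exp (-(Real.sqrt |E|) * s)) r
        - (κ / r) * (CHF_M (((n : ℝ) - 1) / 2 - z) ((n : ℝ) - 1) (2 * Real.sqrt |E| * r)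
            * Real.exp (-(Real.sqrt |E|) * r))
      = E * (CHF_M (((n : ℝ) - 1) / 2 - z) ((n : ℝ) - 1) (2 * Real.sqrt |E| * r)
            * Real.exp (-(Real.sqrt |E|) * r))) := by
  set a : ℝ := ((n : ℝ) - 1) / 2 - z with ha
  set b : ℝ := (n : ℝ) - 1 with hb_def
  have hb : 0 < b := by
    have : (2 : ℝ) ≤ n := by exact_mod_cast hn
    linarith
  set μ : ℝ := Real.sqrt |E| with hμ_def
  have hμ : μ = κ / (2 * z) := by
    rw [hμ_def, show |E| = (κ / (2 * z)) ^ 2 by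
      rw [hE, neg_div, abs_neg, abs_of_nonneg (by positivity)]
      ring]
    exact Real.sqrt_sq (by positivity)
  have hEμ : E = -μ ^ 2 := by
    rw [hE, hμ]
    ring
  have hκμ : κ = 2 * μ * z := by
    rw [hμ]
    field_simp
  obtain ⟨dM, d2M, hdM, hd2M, hode⟩ := exists_hasDerivAt_CHF_M_kummer a hb
  have hlin : ∀ s : ℝ, HasDerivAt (fun s : ℝ => 2 * μ * s) (2 * μ) s := fun s => by
    simpa using (hasDerivAt_id s).const_mul (2 * μ)
  have hexp : ∀ s : ℝ, HasDerivAt (fun s : ℝ => Real.exp (-μ * s)) (-μ * Real.exp (-μ * s)) s :=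
    fun s => by simpa [mul_comm] using ((hasDerivAt_id s).const_mul (-μ)).exp
  have hu : ∀ s : ℝ, HasDerivAt (fun s : ℝ => CHF_M a b (2 * μ * s) * Real.exp (-μ * s))
      ((2 * μ * dM (2 * μ * s) - μ * CHF_M a b (2 * μ * s)) * Real.exp (-μ * s)) s := fun s => by
    refine (((hdM (2 * μ * s)).comp s (hlin s)).mul (hexp s)).congr_deriv ?_
    simp only [Function.comp_apply]
    ring
  have hderiv := funext fun s => (hu s).deriv
  have hu' : ∀ s : ℝ, HasDerivAt
      (fun s : ℝ => (2 * μ * dM (2 * μ * s) - μ * CHF_M a b (2 * μ * s)) * Real.exp (-μ * s))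
      ((4 * μ ^ 2 * d2M (2 * μ * s) - 4 * μ ^ 2 * dM (2 * μ * s)
        + μ ^ 2 * CHF_M a b (2 * μ * s)) * Real.exp (-μ * s)) s := fun s => by
    refine (((((hd2M (2 * μ * s)).comp s (hlin s)).const_mul (2 * μ)).sub
      (((hdM (2 * μ * s)).comp s (hlin s)).const_mul μ)).mul (hexp s)).congr_deriv ?_
    simp only [Function.comp_apply, Pi.sub_apply]
    ring
  refine ⟨fun r _ => (hu r).differentiableAt, fun r _ => ?_, fun r hr => ?_⟩
  · rw [hderiv]
    exact (hu' r).differentiableAt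
  · rw [hderiv, (hu' r).deriv, hEμ, hκμ]
    have hz' : z = b / 2 - a := by
      rw [ha]
      ring
    rw [hz']
    beta_reduce
    have hkummer := hode (2 * μ * r)
    generalize CHF_M a b (2 * μ * r) = m, dM (2 * μ * r) = dm, d2M (2 * μ * r) = d2m at *
    field_simp
    linear_combination (-2 * μ) * hkummer
end

section
/- Let n ≥ 2 be an integer, set m = (n−3)/2, let κ > 0 be real, let γ be real with |γ| < κ/(2(m+1)), and let z ∈ (0, m+1) be such that ρ₋(z) := log(1 − 2γz/κ) + log((m+1)/(m+1−z)) > 0. Then, writing a₀ = m + 1 − z and b₀ = 2m + 2, for every ρ with 0 < ρ < ρ₋(z) one has 2·(a₀/b₀)·M(a₀+1, b₀+1; ρ) < (1 − 2γz/κ)·M(a₀, b₀; ρ). -/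
theorem risingFactorial_pos {a : ℝ} (ha : 0 < a) (k : ℕ) : 0 < risingFactorial a k :=
  Finset.prod_pos fun _ _ => by positivity

theorem risingFactorial_le_risingFactorial {a b : ℝ} (ha : 0 < a) (hab : a ≤ b) (k : ℕ) :
    risingFactorial a k ≤ risingFactorial b k :=
  Finset.prod_le_prod (fun _ _ => by positivity) fun _ _ => by gcongr

theorem CHF_M_term_nonneg {a b ρ : ℝ} (ha : 0 < a) (hb : 0 < b) (hρ : 0 ≤ ρ) (k : ℕ) :
    0 ≤ risingFactorial a k / risingFactorial b k * ρ ^ k / (Nat.factorial k : ℝ) := by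
  have := risingFactorial_pos ha k
  have := risingFactorial_pos hb k
  positivity

theorem CHF_M_term_le {a b ρ : ℝ} (ha : 0 < a) (hab : a ≤ b) (hρ : 0 ≤ ρ) (k : ℕ) :
    risingFactorial a k / risingFactorial b k * ρ ^ k / (Nat.factorial k : ℝ)
      ≤ ρ ^ k / (Nat.factorial k : ℝ) := by
  have hle : risingFactorial a k / risingFactorial b k ≤ 1 :=
    div_le_one_of_le₀ (risingFactorial_le_risingFactorial ha hab k)
      (risingFactorial_pos (ha.trans_le hab) k).le
  gcongr
  exact mul_le_of_le_one_left (by positivity) hle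

theorem summable_CHF_M_term {a b ρ : ℝ} (ha : 0 < a) (hab : a ≤ b) (hρ : 0 ≤ ρ) :
    Summable fun k : ℕ =>
      risingFactorial a k / risingFactorial b k * ρ ^ k / (Nat.factorial k : ℝ) :=
  Summable.of_nonneg_of_le (CHF_M_term_nonneg ha (ha.trans_le hab) hρ)
    (CHF_M_term_le ha hab hρ) (Real.summable_pow_div_factorial ρ)

theorem CHF_M_le_exp {a b ρ : ℝ} (ha : 0 < a) (hab : a ≤ b) (hρ : 0 ≤ ρ) :
    CHF_M a b ρ ≤ Real.exp ρ := by
  rw [Real.exp_eq_exp_ℝ, NormedSpace.exp_eq_tsum_div]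
  exact (summable_CHF_M_term ha hab hρ).tsum_le_tsum (CHF_M_term_le ha hab hρ)
    (Real.summable_pow_div_factorial ρ)

theorem one_le_CHF_M {a b ρ : ℝ} (ha : 0 < a) (hab : a ≤ b) (hρ : 0 ≤ ρ) :
    1 ≤ CHF_M a b ρ := by
  simpa [CHF_M, risingFactorial] using (summable_CHF_M_term ha hab hρ).le_tsum 0
    fun k _ => CHF_M_term_nonneg ha (ha.trans_le hab) hρ k

/-- Let `n ≥ 2`, `m = (n−3)/2`, `κ > 0`, `|γ| < κ/(2(m+1))`, and `z ∈ (0, m+1)` with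
`ρ₋(z) = log(1 − 2γz/κ) + log((m+1)/(m+1−z)) > 0`.  Then, with `a₀ = m + 1 − z` and
`b₀ = 2m + 2`, for every `0 < ρ < ρ₋(z)` one has
`2 (a₀/b₀) M(a₀+1,b₀+1;ρ) < (1 − 2γz/κ) M(a₀,b₀;ρ)`. -/
theorem transcendental_neg_below (n : ℕ) (hn : 2 ≤ n) (m : ℝ) (hm : m = ((n : ℝ) - 3) / 2)
    (κ γ : ℝ) (hκ : 0 < κ) (hγ : |γ| < κ / (2 * (m + 1)))
    (z : ℝ) (hz : z ∈ Set.Ioo (0 : ℝ) (m + 1))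
    (hρm : 0 < Real.log (1 - 2 * γ * z / κ) + Real.log ((m + 1) / (m + 1 - z))) :
    ∀ ρ : ℝ, 0 < ρ →
      ρ < Real.log (1 - 2 * γ * z / κ) + Real.log ((m + 1) / (m + 1 - z)) →
      2 * ((m + 1 - z) / (2 * m + 2)) * CHF_M (m + 1 - z + 1) (2 * m + 2 + 1) ρ
        < (1 - 2 * γ * z / κ) * CHF_M (m + 1 - z) (2 * m + 2) ρ := by
  intro ρ hρ hlt
  obtain ⟨hz0, hz1⟩ := hz
  have hm1 : 0 < m + 1 := hz0.trans hz1
  have ha : 0 < m + 1 - z := sub_pos.2 hz1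
  have hab : m + 1 - z ≤ 2 * m + 2 := by linarith
  have hC : 0 < 1 - 2 * γ * z / κ := by
    have h1 : γ * (2 * (m + 1)) < κ :=
      (lt_div_iff₀ (by positivity)).1 ((le_abs_self γ).trans_lt hγ)
    rw [sub_pos, div_lt_one hκ]
    rcases le_or_gt γ 0 with h | h
    · nlinarith
    · nlinarith
  rw [← Real.log_mul hC.ne' (by positivity), Real.lt_log_iff_exp_lt (by positivity)] at hlt
  calc 2 * ((m + 1 - z) / (2 * m + 2)) * CHF_M (m + 1 - z + 1) (2 * m + 2 + 1) ρ
      = (m + 1 - z) / (m + 1) * CHF_M (m + 1 - z + 1) (2 * m + 2 + 1) ρ := by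
        congr 1
        rw [show 2 * m + 2 = 2 * (m + 1) by ring]
        field_simp
    _ ≤ (m + 1 - z) / (m + 1) * Real.exp ρ := by
        gcongr
        exact CHF_M_le_exp (by linarith) (by linarith) hρ.le
    _ < (m + 1 - z) / (m + 1) * ((1 - 2 * γ * z / κ) * ((m + 1) / (m + 1 - z))) := by
        gcongr
    _ = 1 - 2 * γ * z / κ := by field_simp
    _ ≤ (1 - 2 * γ * z / κ) * CHF_M (m + 1 - z) (2 * m + 2) ρ :=
        le_mul_of_one_le_right hC.le (one_le_CHF_M ha hab hρ.le)
end

section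
/- Let n ≥ 2 be an integer, let κ > 0 be real, let γ be real with |γ| < κ/(n−1), and let ε ∈ (0,1). Then there exist constants C > 0 and R₀ > 0 such that for every R ≥ R₀ there exists z ∈ (0, (n−1)/2) satisfying both the transcendental equation 2·(a₀/b₀)·M(a₀+1, b₀+1; κR/z) = (1 − 2γz/κ)·M(a₀, b₀; κR/z), where a₀ = (n−1)/2 − z and b₀ = n−1, and the estimate |z − (n−1)/2| ≤ C·exp(−2(1−ε)κR/(n−1)). -/
open Set Real

lemma risingFactorial_succ (a : ℝ) (k : ℕ) :
    risingFactorial a (k + 1) = risingFactorial a k * (a + k) := by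
  simp [risingFactorial, Finset.prod_range_succ]

lemma risingFactorial_succ' (a : ℝ) (k : ℕ) :
    risingFactorial a (k + 1) = a * risingFactorial (a + 1) k := by
  simp only [risingFactorial, Finset.prod_range_succ']
  push_cast
  rw [mul_comm]
  congr 1
  · simp
  · exact Finset.prod_congr rfl fun i _ => by ring

lemma risingFactorial_nonneg {a : ℝ} (ha : 0 ≤ a) (k : ℕ) : 0 ≤ risingFactorial a k :=
  Finset.prod_nonneg fun _ _ => by positivity

lemma risingFactorial_mono {a b : ℝ} (ha : 0 ≤ a) (hab : a ≤ b) (k : ℕ) :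
    risingFactorial a k ≤ risingFactorial b k :=
  Finset.prod_le_prod (fun _ _ => by positivity) fun _ _ => by gcongr

lemma risingFactorial_div_nonneg {a b : ℝ} (ha : 0 ≤ a) (hb : 0 ≤ b) (k : ℕ) :
    0 ≤ risingFactorial a k / risingFactorial b k :=
  div_nonneg (risingFactorial_nonneg ha k) (risingFactorial_nonneg hb k)

lemma risingFactorial_div_le_one {a b : ℝ} (ha : 0 ≤ a) (hab : a ≤ b) (k : ℕ) :
    risingFactorial a k / risingFactorial b k ≤ 1 :=
  div_le_one_of_le₀ (risingFactorial_mono ha hab k) (risingFactorial_nonneg (ha.trans hab) k)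

lemma risingFactorial_div_succ (a b : ℝ) (k : ℕ) :
    risingFactorial a (k + 1) / risingFactorial b (k + 1) =
      risingFactorial a k / risingFactorial b k * ((a + k) / (b + k)) := by
  rw [risingFactorial_succ, risingFactorial_succ, mul_div_mul_comm]

lemma risingFactorial_div_succ' (a b : ℝ) (k : ℕ) :
    risingFactorial a (k + 1) / risingFactorial b (k + 1) =
      a / b * (risingFactorial (a + 1) k / risingFactorial (b + 1) k) := by
  rw [risingFactorial_succ', risingFactorial_succ', mul_div_mul_comm]

lemma risingFactorial_div_le {a b : ℝ} (ha : 0 ≤ a) (hab : a ≤ b) (hb : 1 ≤ b) {k : ℕ}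
    (hk : k ≠ 0) : risingFactorial a k / risingFactorial b k ≤ a := by
  obtain ⟨j, rfl⟩ := Nat.exists_eq_succ_of_ne_zero hk
  rw [Nat.succ_eq_add_one, risingFactorial_div_succ']
  calc _ ≤ a / b * 1 := by
        gcongr
        exact risingFactorial_div_le_one (by linarith) (by linarith) j
    _ ≤ a := by rw [mul_one]; exact div_le_self ha hb

/-- At a fixed positive index the ratio of rising factorials is at least linear in `a`. -/
lemma exists_mul_le_risingFactorial_div {b : ℝ} (hb : 0 < b) (k : ℕ) :
    ∃ c : ℝ, 0 < c ∧ ∀ a : ℝ, 0 ≤ a →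
      a * c ≤ risingFactorial a (k + 1) / risingFactorial b (k + 1) := by
  induction k with
  | zero =>
    refine ⟨1 / b, by positivity, fun a _ => ?_⟩
    simp [risingFactorial, div_eq_mul_inv]
  | succ k ih =>
    obtain ⟨c, hc, h⟩ := ih
    refine ⟨c * (((k + 1 : ℕ) : ℝ) / (b + (k + 1 : ℕ))), by positivity, fun a ha => ?_⟩
    rw [risingFactorial_div_succ, ← mul_assoc]
    refine mul_le_mul (h a ha) ?_ (by positivity) (risingFactorial_div_nonneg ha hb.le _)
    gcongr
    linarith

lemma exists_nat_forall_le_div_add {b τ : ℝ} (hb : 0 < b) (hτ : τ < 1) :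
    ∃ K : ℕ, ∀ k : ℕ, K ≤ k → τ ≤ (k : ℝ) / (b + k) := by
  obtain ⟨K, hK⟩ := exists_nat_ge (τ * b / (1 - τ))
  refine ⟨K, fun k hk => ?_⟩
  have hk' : (K : ℝ) ≤ k := by exact_mod_cast hk
  rw [le_div_iff₀ (by positivity)]
  have := (div_le_iff₀ (by linarith)).1 (hK.trans hk')
  linarith

/-- The ratio of rising factorials decays slower than any geometric sequence. -/
lemma exists_mul_pow_le_risingFactorial_div {b θ : ℝ} (hb : 0 < b) (hθ0 : 0 < θ) {K : ℕ}
    (hK : ∀ k : ℕ, K + 1 ≤ k → θ ≤ (k : ℝ) / (b + k)) :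
    ∃ c : ℝ, 0 < c ∧ ∀ a : ℝ, 0 ≤ a → ∀ k : ℕ, K + 1 ≤ k →
      a * c * θ ^ k ≤ risingFactorial a k / risingFactorial b k := by
  obtain ⟨c, hc, h⟩ := exists_mul_le_risingFactorial_div hb K
  refine ⟨c / θ ^ (K + 1), by positivity, fun a ha k hk => ?_⟩
  induction k, hk using Nat.le_induction with
  | base =>
    refine le_trans (le_of_eq ?_) (h a ha)
    field_simp
  | succ k hk ih =>
    rw [risingFactorial_div_succ, pow_succ θ k, ← mul_assoc]
    have h1 : θ ≤ (a + k) / (b + k) := (hK k hk).trans (by gcongr; linarith)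
    exact mul_le_mul ih h1 hθ0.le (risingFactorial_div_nonneg ha hb.le k)

lemma norm_CHF_M_term_le {a b ρ P : ℝ} (ha : 0 ≤ a) (hab : a ≤ b) (hρ : 0 ≤ ρ) (hP : ρ ≤ P)
    (k : ℕ) :
    ‖risingFactorial a k / risingFactorial b k * ρ ^ k / (Nat.factorial k : ℝ)‖ ≤
      P ^ k / (Nat.factorial k : ℝ) := by
  have h0 := risingFactorial_div_nonneg ha (ha.trans hab) k
  rw [Real.norm_of_nonneg (by positivity)]
  gcongr
  calc _ ≤ 1 * ρ ^ k := by gcongr; exact risingFactorial_div_le_one ha hab k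
    _ ≤ P ^ k := by rw [one_mul]; gcongr

lemma summable_CHF_M {a b ρ : ℝ} (ha : 0 ≤ a) (hab : a ≤ b) (hρ : 0 ≤ ρ) :
    Summable fun k : ℕ =>
      risingFactorial a k / risingFactorial b k * ρ ^ k / (Nat.factorial k : ℝ) :=
  .of_norm_bounded (Real.summable_pow_div_factorial ρ) (norm_CHF_M_term_le ha hab hρ le_rfl)

lemma continuousOn_CHF_M {s : Set ℝ} {f g : ℝ → ℝ} {b P : ℝ} (hf : ContinuousOn f s)
    (hg : ContinuousOn g s) (hf0 : ∀ x ∈ s, 0 ≤ f x) (hfb : ∀ x ∈ s, f x ≤ b)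
    (hg0 : ∀ x ∈ s, 0 ≤ g x) (hgP : ∀ x ∈ s, g x ≤ P) :
    ContinuousOn (fun x => CHF_M (f x) b (g x)) s := by
  unfold CHF_M
  refine continuousOn_tsum (u := fun k : ℕ => P ^ k / (Nat.factorial k : ℝ)) (fun k => ?_)
    (Real.summable_pow_div_factorial P) fun k x hx =>
      norm_CHF_M_term_le (hf0 x hx) (hfb x hx) (hg0 x hx) (hgP x hx) k
  unfold risingFactorial
  fun_prop

lemma hasSum_derivative_sub_CHF_M {a b ρ : ℝ} (c : ℝ) (ha : 0 ≤ a) (hab : a ≤ b) (hρ : 0 ≤ ρ) :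
    HasSum (fun k : ℕ => risingFactorial a k / risingFactorial b k *
        (2 * ((a + k) / (b + k)) - c) * (ρ ^ k / (Nat.factorial k : ℝ)))
      (2 * (a / b) * CHF_M (a + 1) (b + 1) ρ - c * CHF_M a b ρ) := by
  have h1 := (summable_CHF_M (a := a + 1) (b := b + 1) (by linarith) (by linarith) hρ).hasSum
  have h2 := (summable_CHF_M ha hab hρ).hasSum
  refine ((h1.mul_left (2 * (a / b))).sub (h2.mul_left c)).congr_fun ?_
  intro k
  have := (risingFactorial_div_succ' a b k).symm.trans (risingFactorial_div_succ a b k)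
  linear_combination (-2 * ρ ^ k / (Nat.factorial k : ℝ)) * this

lemma hasSum_exp_mul (t ρ : ℝ) :
    HasSum (fun k : ℕ => t ^ k * (ρ ^ k / (Nat.factorial k : ℝ))) (exp (t * ρ)) := by
  have := NormedSpace.expSeries_div_hasSum_exp (𝔸 := ℝ) (t * ρ)
  rw [← Real.exp_eq_exp_ℝ] at this
  simpa only [mul_pow, mul_div_assoc] using this

/-- A lower bound for `2 M' - c M` by a difference of exponentials, uniform in `a` and `c`. -/
lemma exists_exp_lower_bound {b θ φ c₀ : ℝ} (hb : 1 ≤ b) (hφ0 : 0 < φ) (hφ : φ < 1)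
    (hθ0 : 0 < θ) (hθ : θ < 1) (hc₀ : c₀ < 2) :
    ∃ A c' : ℝ, 0 < A ∧ 0 < c' ∧ ∀ a c ρ : ℝ, 0 ≤ a → a ≤ b → c ≤ c₀ → 0 ≤ ρ →
      a * (c' * exp (θ * ρ) - A * exp (φ * ρ)) - 2 ≤
        2 * (a / b) * CHF_M (a + 1) (b + 1) ρ - c * CHF_M a b ρ := by
  have hb0 : 0 < b := by linarith
  obtain ⟨K, hK⟩ := exists_nat_forall_le_div_add hb0
    (max_lt hθ (by linarith : (2 + c₀) / 4 < 1))
  obtain ⟨d, hd, hdk⟩ := exists_mul_pow_le_risingFactorial_div hb0 hθ0 (K := K)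
    fun k hk => (le_max_left _ _).trans (hK k (by lia))
  have hη : 0 < (2 - c₀) / 2 := by linarith
  set c' := d * ((2 - c₀) / 2) with hc'
  have hc'0 : 0 < c' := by positivity
  refine ⟨(2 + c') / φ ^ (K + 1), c', by positivity, hc'0, fun a c ρ ha hab hc hρ => ?_⟩
  set A := (2 + c') / φ ^ (K + 1) with hA
  have hA0 : 0 < A := by positivity
  have hAφ : ∀ k : ℕ, k ≤ K + 1 → 2 + c' ≤ A * φ ^ k := fun k hk => by
    calc 2 + c' = A * φ ^ (K + 1) := by rw [hA]; field_simp
      _ ≤ A * φ ^ k := by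
        gcongr ?_ * ?_
        exact pow_le_pow_of_le_one hφ0.le hφ.le hk
  have hone : HasSum (fun k : ℕ => (if k = 0 then (2 : ℝ) else 0)) 2 := hasSum_ite_eq 0 2
  have hlow := ((((hasSum_exp_mul θ ρ).mul_left c').sub
    ((hasSum_exp_mul φ ρ).mul_left A)).mul_left a).sub hone
  refine hasSum_le (fun k => ?_) hlow (hasSum_derivative_sub_CHF_M c ha hab hρ)
  have hfrac : 0 ≤ (a + k) / (b + k) := by positivity
  have hθk : θ ^ k ≤ 1 := pow_le_one₀ hθ0.le hθ.le
  have hw : 0 ≤ ρ ^ k / (Nat.factorial k : ℝ) := by positivity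
  rcases Nat.eq_zero_or_pos k with rfl | hkpos
  · have h0 := hAφ 0 (by lia)
    have hab0 : 0 ≤ a / b := by positivity
    simp only [risingFactorial, pow_zero] at h0 ⊢
    norm_num
    nlinarith
  · have hk0 : k ≠ 0 := hkpos.ne'
    set p := risingFactorial a k / risingFactorial b k with hp
    have hp0 : 0 ≤ p := risingFactorial_div_nonneg ha hb0.le k
    have hpa : p ≤ a := risingFactorial_div_le ha hab hb hk0
    suffices h : a * (c' * θ ^ k - A * φ ^ k) ≤ p * (2 * ((a + k) / (b + k)) - c) by
      have := mul_le_mul_of_nonneg_right h hw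
      simp only [hk0, if_false]
      linarith
    rcases le_total (K + 1) k with hk | hk
    · have h1 : (2 + c₀) / 4 ≤ (a + k) / (b + k) :=
        ((le_max_right _ _).trans (hK k (by lia))).trans (by gcongr; linarith)
      have h2 : p * ((2 - c₀) / 2) ≤ p * (2 * ((a + k) / (b + k)) - c) := by
        gcongr
        linarith
      have h3 := mul_le_mul_of_nonneg_right (hdk a ha k hk) hη.le
      have h4 : 0 ≤ a * (A * φ ^ k) := by positivity
      rw [hc'] at *
      linarith
    · have h1 := mul_le_mul_of_nonneg_left (hAφ k hk) ha
      have h2 : a * (c' * θ ^ k) ≤ a * c' := by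
        gcongr
        exact mul_le_of_le_one_right hc'0.le hθk
      have h3 : p * (-2) ≤ p * (2 * ((a + k) / (b + k)) - c) := by
        gcongr
        linarith
      linarith

lemma CHF_M_zero_left (b ρ : ℝ) : CHF_M 0 b ρ = 1 := by
  unfold CHF_M
  rw [tsum_eq_single 0]
  · simp [risingFactorial]
  · intro k hk
    obtain ⟨j, rfl⟩ := Nat.exists_eq_succ_of_ne_zero hk
    simp [risingFactorial_succ']

/-- Let `n ≥ 2`, `κ > 0`, `|γ| < κ/(n−1)`, `ε ∈ (0,1)`.  Then there are `C > 0`, `R₀ > 0`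
such that for every `R ≥ R₀` there exists `z ∈ (0, (n−1)/2)` satisfying the transcendental
equation `2 (a₀/b₀) M(a₀+1,b₀+1;κR/z) = (1 − 2γz/κ) M(a₀,b₀;κR/z)` with `a₀ = (n−1)/2 − z`,
`b₀ = n−1`, together with `|z − (n−1)/2| ≤ C exp(−2(1−ε)κR/(n−1))`. -/
theorem transcendental_root_asymptotics (n : ℕ) (hn : 2 ≤ n) (κ γ : ℝ) (hκ : 0 < κ)
    (hγ : |γ| < κ / ((n : ℝ) - 1)) (ε : ℝ) (hε : ε ∈ Set.Ioo (0 : ℝ) 1) :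
    ∃ C : ℝ, 0 < C ∧ ∃ R₀ : ℝ, 0 < R₀ ∧ ∀ R : ℝ, R₀ ≤ R →
      ∃ z ∈ Set.Ioo (0 : ℝ) (((n : ℝ) - 1) / 2),
        2 * ((((n : ℝ) - 1) / 2 - z) / ((n : ℝ) - 1))
            * CHF_M (((n : ℝ) - 1) / 2 - z + 1) ((n : ℝ) - 1 + 1) (κ * R / z)
          = (1 - 2 * γ * z / κ) * CHF_M (((n : ℝ) - 1) / 2 - z) ((n : ℝ) - 1) (κ * R / z) ∧
        |z - ((n : ℝ) - 1) / 2| ≤ C * Real.exp (-2 * (1 - ε) * κ * R / ((n : ℝ) - 1)) := by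
  obtain ⟨hε0, hε1⟩ := hε
  have hn' : (2 : ℝ) ≤ n := by exact_mod_cast hn
  set b : ℝ := (n : ℝ) - 1 with hbdef
  have hb : 1 ≤ b := by linarith
  have hb0 : 0 < b := by linarith
  have hg : |γ| * b / κ < 1 := by
    rw [div_lt_one hκ]
    exact (lt_div_iff₀ hb0).1 hγ
  have hcoef : ∀ z : ℝ, 0 ≤ z → z ≤ b / 2 → |2 * γ * z / κ| ≤ |γ| * b / κ := fun z hz hzb => by
    rw [abs_div, abs_of_pos hκ, abs_mul, abs_mul, abs_of_nonneg hz, abs_two]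
    gcongr ?_ / κ
    nlinarith [abs_nonneg γ]
  obtain ⟨A, c', hA, hc', hlow⟩ := exists_exp_lower_bound (θ := 1 - ε / 2) (φ := 1 - ε)
    (c₀ := 1 + |γ| * b / κ) hb (by linarith) (by linarith) (by linarith) (by linarith)
    (by linarith)
  set ρ₀ := max (1 / (1 - ε)) (log ((A + 3) / c') / (ε / 2)) with hρ₀
  have hε1' : 0 < 1 - ε := by linarith
  have hρ₀pos : 0 < ρ₀ := lt_max_of_lt_left (by positivity)
  have hdom : ∀ ρ : ℝ, ρ₀ ≤ ρ →
      3 * exp ((1 - ε) * ρ) ≤ c' * exp ((1 - ε / 2) * ρ) - A * exp ((1 - ε) * ρ) := by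
    intro ρ hρ
    have h1 := (div_le_iff₀ (by linarith)).1 ((le_max_right _ _).trans hρ)
    have h2 : (A + 3) / c' ≤ exp (ρ * (ε / 2)) := (log_le_iff_le_exp (by positivity)).1 h1
    rw [div_le_iff₀ hc'] at h2
    have h3 : exp ((1 - ε / 2) * ρ) = exp (ρ * (ε / 2)) * exp ((1 - ε) * ρ) := by
      rw [← exp_add]; ring_nf
    rw [h3]
    have := mul_le_mul_of_nonneg_right h2 (exp_pos ((1 - ε) * ρ)).le
    linarith
  refine ⟨1, one_pos, b * ρ₀ / (2 * κ), by positivity, fun R hR => ?_⟩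
  have hx : ρ₀ ≤ 2 * κ * R / b := by
    rw [le_div_iff₀ hb0]
    rw [div_le_iff₀ (by positivity)] at hR
    linarith
  have hRpos : 0 < R := lt_of_lt_of_le (by positivity) hR
  set δ := exp (-2 * (1 - ε) * κ * R / b) with hδ
  have hδ' : δ = exp (-((1 - ε) * (2 * κ * R / b))) := by rw [hδ]; congr 1; ring
  have hδ0 : 0 < δ := exp_pos _
  have hδb : δ < b / 2 := by
    have h1 : 1 ≤ (1 - ε) * (2 * κ * R / b) := by
      have := (div_le_iff₀ hε1').1 ((le_max_left _ _).trans hx)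
      linarith
    have h2 : δ ≤ exp (-1) := by rw [hδ']; gcongr
    have h3 := exp_neg_one_lt_half
    linarith
  set F : ℝ → ℝ := fun a => 2 * (a / b) * CHF_M (a + 1) (b + 1) (κ * R / (b / 2 - a))
    - (1 - 2 * γ * (b / 2 - a) / κ) * CHF_M a b (κ * R / (b / 2 - a)) with hF
  have hFcont : ContinuousOn F (Icc 0 δ) := by
    have hg : ContinuousOn (fun a => κ * R / (b / 2 - a)) (Icc 0 δ) :=
      ContinuousOn.div (by fun_prop) (by fun_prop) fun a ha => by linarith [ha.2]
    have hg0 : ∀ a ∈ Icc 0 δ, 0 ≤ κ * R / (b / 2 - a) := fun a ha =>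
      div_nonneg (by positivity) (by linarith [ha.2])
    have hgP : ∀ a ∈ Icc 0 δ, κ * R / (b / 2 - a) ≤ κ * R / (b / 2 - δ) := fun a ha =>
      div_le_div_of_nonneg_left (by positivity) (by linarith) (by linarith [ha.2])
    have h1 := continuousOn_CHF_M (f := fun a => a + 1) (b := b + 1) (by fun_prop) hg
      (fun a ha => by linarith [ha.1]) (fun a ha => by linarith [ha.2]) hg0 hgP
    have h2 := continuousOn_CHF_M (f := fun a => a) (b := b) (by fun_prop) hg
      (fun a ha => ha.1) (fun a ha => by linarith [ha.2]) hg0 hgP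
    exact (ContinuousOn.mul (by fun_prop) h1).sub (ContinuousOn.mul (by fun_prop) h2)
  have hF0 : F 0 < 0 := by
    have := (abs_le.1 (hcoef (b / 2) (by positivity) le_rfl)).2
    simp only [hF, CHF_M_zero_left, sub_zero]
    norm_num
    linarith
  have hFδ : 0 < F δ := by
    set ρ := κ * R / (b / 2 - δ) with hρ
    have hxρ : 2 * κ * R / b ≤ ρ := by
      calc 2 * κ * R / b = κ * R / (b / 2) := by field_simp
        _ ≤ ρ := div_le_div_of_nonneg_left (by positivity) (by linarith) (by linarith)
    have hc := (abs_le.1 (hcoef (b / 2 - δ) (by linarith) (by linarith))).1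
    have h1 := hlow δ (1 - 2 * γ * (b / 2 - δ) / κ) ρ hδ0.le (by linarith) (by linarith)
      (hρ₀pos.le.trans (hx.trans hxρ))
    have h2 := mul_le_mul_of_nonneg_left (hdom ρ (hx.trans hxρ)) hδ0.le
    have h3 : 1 ≤ δ * exp ((1 - ε) * ρ) := by
      rw [hδ', ← exp_add]
      apply one_le_exp
      have := mul_le_mul_of_nonneg_left hxρ hε1'.le
      linarith
    have h4 : F δ = 2 * (δ / b) * CHF_M (δ + 1) (b + 1) ρ
        - (1 - 2 * γ * (b / 2 - δ) / κ) * CHF_M δ b ρ := rfl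
    rw [h4]
    linarith
  obtain ⟨a, ha, hFa⟩ := intermediate_value_Ioo hδ0.le hFcont ⟨hF0, hFδ⟩
  refine ⟨b / 2 - a, ⟨by linarith [ha.2], by linarith [ha.1]⟩, ?_, ?_⟩
  · rw [sub_sub_cancel]
    exact sub_eq_zero.1 hFa
  · rw [sub_sub_cancel_left, abs_neg, abs_of_pos ha.1, one_mul]
    exact ha.2.le
end

section
/- Let n ≥ 2 be an integer, let α < 0 be real, and let θ ∈ (0,π). Let C_θ = {(x,y) ∈ (0,∞) × ℝ^{n−1} : |y| < tan(θ/2)·x} be the infinite open cone of opening angle θ in ℝⁿ. Then ∫_{C_θ} e^{2αx/sin(θ/2)} dV = (π^{(n−1)/2}/Γ((n+1)/2)) · Γ(n) · tan^{n−1}(θ/2) · (sin(θ/2)/(2|α|))^n, where dV denotes n-dimensional Lebesgue measure and Γ is the Gamma function. -/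
open Real MeasureTheory

lemma EuclideanSpace.volumeReal_ball {m : ℕ} [NeZero m] {r : ℝ} (hr : 0 ≤ r) :
    volume.real (Metric.ball (0 : EuclideanSpace ℝ (Fin m)) r) =
      r ^ m * (√π ^ m / Real.Gamma ((m : ℝ) / 2 + 1)) := by
  have hΓ : 0 < Real.Gamma ((m : ℝ) / 2 + 1) := Real.Gamma_pos_of_pos (by positivity)
  rw [Measure.real, EuclideanSpace.volume_ball, Fintype.card_fin, ENNReal.toReal_mul,
    ENNReal.toReal_pow, ENNReal.toReal_ofReal hr, ENNReal.toReal_ofReal (by positivity)]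

/-- The integral of `exp (-b x)` over the cone `{(x, y) | 0 < x, ‖y‖ < t x}` in `ℝ × ℝᵐ`. -/
lemma setIntegral_cone_exp_neg_mul {m : ℕ} [NeZero m] {t b : ℝ} (ht : 0 < t) (hb : 0 < b) :
    ∫ p in {p : ℝ × EuclideanSpace ℝ (Fin m) | 0 < p.1 ∧ ‖p.2‖ < t * p.1}, Real.exp (-(b * p.1)) =
      √π ^ m / Real.Gamma ((m : ℝ) / 2 + 1) * Real.Gamma ((m : ℝ) + 1) * t ^ m
        * (1 / b) ^ (m + 1) := by
  set C := {p : ℝ × EuclideanSpace ℝ (Fin m) | 0 < p.1 ∧ ‖p.2‖ < t * p.1} with hC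
  set c := √π ^ m / Real.Gamma ((m : ℝ) / 2 + 1)
  set f : ℝ × EuclideanSpace ℝ (Fin m) → ℝ := C.indicator fun p => Real.exp (-(b * p.1)) with hf
  have hCm : MeasurableSet C :=
    (measurableSet_lt measurable_const measurable_fst).inter
      (measurableSet_lt measurable_snd.norm (measurable_fst.const_mul t))
  have hfm : Measurable f := Measurable.indicator (by fun_prop) hCm
  have hf0 (p) : 0 ≤ f p := Set.indicator_nonneg (fun _ _ => (Real.exp_pos _).le) p
  have hsec (x : ℝ) : (fun y => f (x, y)) =
      (Metric.ball 0 (t * x)).indicator fun _ => Real.exp (-(b * x)) := by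
    ext y
    by_cases hy : ‖y‖ < t * x
    · have hx : 0 < x := pos_of_mul_pos_right ((norm_nonneg y).trans_lt hy) ht.le
      simp [hf, hC, hx, hy]
    · simp [hf, hC, hy]
  have hint (x : ℝ) : ∫ y, f (x, y) =
      (Set.Ioi 0).indicator
        (fun x => c * t ^ m * (x ^ (((m : ℝ) + 1) - 1) * Real.exp (-(b * x)))) x := by
    rw [hsec, integral_indicator measurableSet_ball, setIntegral_const]
    by_cases hx : 0 < x
    · rw [Set.indicator_of_mem (Set.mem_Ioi.2 hx),
        EuclideanSpace.volumeReal_ball (by positivity), add_sub_cancel_right, Real.rpow_natCast,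
        smul_eq_mul, mul_pow]
      ring
    · have : Metric.ball (0 : EuclideanSpace ℝ (Fin m)) (t * x) = ∅ :=
        Metric.ball_eq_empty.2 (mul_nonpos_of_nonneg_of_nonpos ht.le (not_lt.1 hx))
      simp [this, hx]
  have hfi : Integrable f (volume.prod volume) := by
    rw [integrable_prod_iff hfm.aestronglyMeasurable]
    refine ⟨ae_of_all _ fun x => ?_, ?_⟩
    · rw [hsec, integrable_indicator_iff measurableSet_ball]
      exact integrableOn_const measure_ball_lt_top.ne
    · simp_rw [Real.norm_of_nonneg (hf0 _), hint]
      rw [integrable_indicator_iff measurableSet_Ioi]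
      have := integrableOn_rpow_mul_exp_neg_mul_rpow (s := ((m : ℝ) + 1) - 1) (p := 1) (b := b)
        (by rw [add_sub_cancel_right]; linarith [m.cast_nonneg (α := ℝ)]) one_pos hb
      simp only [Real.rpow_one, neg_mul] at this
      exact this.const_mul _
  rw [← integral_indicator hCm, Measure.volume_eq_prod, integral_prod _ hfi]
  simp_rw [hint]
  rw [integral_indicator measurableSet_Ioi, integral_const_mul,
    Real.integral_rpow_mul_exp_neg_mul_Ioi (by positivity) hb]
  norm_cast
  ring

/-- Let `n ≥ 2`, `α < 0`, `θ ∈ (0,π)`, and let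
`C_θ = {(x,y) ∈ (0,∞) × ℝ^{n−1} : |y| < tan(θ/2) x}` be the infinite open cone of opening
angle `θ` in `ℝⁿ`.  Then
`∫_{C_θ} e^{2αx/sin(θ/2)} dV = (π^{(n-1)/2}/Γ((n+1)/2)) Γ(n) tan^{n−1}(θ/2) (sin(θ/2)/(2|α|))^n`. -/
theorem cone_ground_state_integral (n : ℕ) (hn : 2 ≤ n) (α : ℝ) (hα : α < 0)
    (θ : ℝ) (hθ : θ ∈ Set.Ioo 0 π) :
    ∫ p in {p : ℝ × EuclideanSpace ℝ (Fin (n - 1)) |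
        0 < p.1 ∧ ‖p.2‖ < Real.tan (θ / 2) * p.1},
      Real.exp (2 * α * p.1 / Real.sin (θ / 2)) =
    (π ^ (((n : ℝ) - 1) / 2) / Real.Gamma (((n : ℝ) + 1) / 2)) * Real.Gamma n
      * Real.tan (θ / 2) ^ (n - 1) * (Real.sin (θ / 2) / (2 * |α|)) ^ n := by
  obtain ⟨h0, hπ⟩ := hθ
  have hs : 0 < Real.sin (θ / 2) := Real.sin_pos_of_pos_of_lt_pi (by linarith) (by linarith)
  have ht : 0 < Real.tan (θ / 2) := Real.tan_pos_of_pos_of_lt_pi_div_two (by linarith) (by linarith)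
  have hα' : 0 < |α| := abs_pos.2 hα.ne
  obtain ⟨m, rfl⟩ : ∃ m, n = m + 1 := ⟨n - 1, by lia⟩
  have : NeZero m := ⟨by lia⟩
  have hexp (x : ℝ) : 2 * α * x / Real.sin (θ / 2) = -(2 * |α| / Real.sin (θ / 2) * x) := by
    rw [abs_of_neg hα]
    ring
  have hsqrt : √π ^ m = π ^ ((m : ℝ) / 2) := by
    rw [Real.sqrt_eq_rpow, ← Real.rpow_mul_natCast Real.pi_pos.le]
    ring_nf
  simp only [hexp, Nat.add_sub_cancel]
  refine (setIntegral_cone_exp_neg_mul (m := m) ht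
    (by positivity : 0 < 2 * |α| / Real.sin (θ / 2))).trans ?_
  rw [one_div_div, hsqrt]
  push_cast
  rw [add_sub_cancel_right, show ((m : ℝ) + 1 + 1) / 2 = (m : ℝ) / 2 + 1 by ring]
end

section
/- Let n ≥ 2 be an integer, let α < 0 be real, let θ ∈ (0,π), and let T > 0. Let C_θ = {(x,y) ∈ (0,∞) × ℝ^{n−1} : |y| < tan(θ/2)·x}. Then the ratio of the integral of e^{2αx/sin(θ/2)} (with respect to n-dimensional Lebesgue measure) over C_θ ∩ {x ≥ T} to its integral over all of C_θ equals (1/Γ(n)) · ∫_{2|α|T/sin(θ/2)}^∞ e^{−y}·y^{n−1} dy. -/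
open Real MeasureTheory

open Set Metric in
/-- The first marginal of Lebesgue measure on the part of a cone lying over `S ⊆ (0,∞)`. -/
theorem map_fst_restrict_cone {E : Type*} [NormedAddCommGroup E] [NormedSpace ℝ E]
    [FiniteDimensional ℝ E] [MeasureSpace E] [BorelSpace E]
    [(volume : Measure E).IsAddHaarMeasure] {S : Set ℝ} (hS : MeasurableSet S) (hS0 : S ⊆ Ioi 0)
    {t : ℝ} (ht : 0 < t) :
    ((volume : Measure (ℝ × E)).restrict {p | p.1 ∈ S ∧ ‖p.2‖ < t * p.1}).map Prod.fst
      = (volume.restrict S).withDensity fun x ↦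
          ENNReal.ofReal ((t * x) ^ Module.finrank ℝ E) * volume (ball (0 : E) 1) := by
  have hC : MeasurableSet {p : ℝ × E | p.1 ∈ S ∧ ‖p.2‖ < t * p.1} :=
    (measurable_fst hS).inter
      (measurableSet_lt (measurable_snd.norm) (measurable_fst.const_mul t))
  ext A hA
  rw [Measure.map_apply measurable_fst hA, Measure.restrict_apply (measurable_fst hA),
    withDensity_apply _ hA, Measure.restrict_restrict hA, Measure.volume_eq_prod,
    Measure.prod_apply ((measurable_fst hA).inter hC), ← lintegral_indicator (hA.inter hS)]
  refine lintegral_congr fun x ↦ ?_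
  by_cases hx : x ∈ A ∩ S
  · rw [indicator_of_mem hx,
      ← Measure.addHaar_ball_of_pos volume (0 : E) (mul_pos ht (hS0 hx.2))]
    congr 1
    ext y
    simp [hx.1, hx.2]
  · rw [indicator_of_notMem hx]
    convert measure_empty (μ := (volume : Measure E))
    ext y
    simp only [mem_preimage, mem_inter_iff, mem_ofPred_eq, mem_empty_iff_false, iff_false]
    exact fun h ↦ hx ⟨h.1, h.2.1⟩

open Set Metric in
/-- Integrating a function of the axial coordinate over the part of a cone lying over `S`. -/
theorem setIntegral_cone_comp_fst {E : Type*} [NormedAddCommGroup E] [NormedSpace ℝ E]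
    [FiniteDimensional ℝ E] [MeasureSpace E] [BorelSpace E]
    [(volume : Measure E).IsAddHaarMeasure] {S : Set ℝ} (hS : MeasurableSet S) (hS0 : S ⊆ Ioi 0)
    {t : ℝ} (ht : 0 < t) {g : ℝ → ℝ} (hg : Measurable g) :
    ∫ p in {p : ℝ × E | p.1 ∈ S ∧ ‖p.2‖ < t * p.1}, g p.1
      = t ^ Module.finrank ℝ E * volume.real (ball (0 : E) 1)
          * ∫ x in S, g x * x ^ Module.finrank ℝ E := by
  rw [← integral_map (f := g) measurable_fst.aemeasurable hg.aestronglyMeasurable,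
    map_fst_restrict_cone hS hS0 ht,
    integral_withDensity_eq_integral_toReal_smul (by fun_prop)
      (ae_of_all _ fun x ↦ ENNReal.mul_lt_top ENNReal.ofReal_lt_top measure_ball_lt_top),
    ← integral_const_mul]
  refine setIntegral_congr_fun hS fun x hx ↦ ?_
  have hx0 : 0 < x := hS0 hx
  simp only [ENNReal.toReal_mul, smul_eq_mul]
  rw [ENNReal.toReal_ofReal (by positivity), mul_pow, Measure.real]
  ring

open Set in
/-- Rescaling of the incomplete Gamma integral. -/
theorem integral_Ioi_exp_neg_mul_mul_pow {k : ℝ} (hk : 0 < k) (a : ℝ) (d : ℕ) :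
    ∫ x in Ioi a, rexp (-(k * x)) * x ^ d
      = (k ^ (d + 1))⁻¹ * ∫ y in Ioi (k * a), rexp (-y) * y ^ d := by
  have h := integral_comp_mul_left_Ioi (fun y ↦ rexp (-y) * y ^ d) a hk
  simp only [mul_pow, smul_eq_mul, mul_left_comm _ (k ^ d)] at h
  rw [integral_const_mul] at h
  rw [pow_succ, mul_inv, mul_assoc, ← h, inv_mul_cancel_left₀ (by positivity)]

/-- Let `n ≥ 2`, `α < 0`, `θ ∈ (0,π)`, `T > 0`, and let
`C_θ = {(x,y) ∈ (0,∞) × ℝ^{n−1} : |y| < tan(θ/2) x}`.  Then the ratio of the integral of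
`e^{2αx/sin(θ/2)}` over `C_θ ∩ {x ≥ T}` to its integral over `C_θ` equals
`(1/Γ(n)) ∫_{2|α|T/sin(θ/2)}^∞ e^{−y} y^{n−1} dy`. -/
theorem cone_tail_mass_ratio (n : ℕ) (hn : 2 ≤ n) (α : ℝ) (hα : α < 0)
    (θ : ℝ) (hθ : θ ∈ Set.Ioo 0 π) (T : ℝ) (hT : 0 < T) :
    (∫ p in {p : ℝ × EuclideanSpace ℝ (Fin (n - 1)) |
          0 < p.1 ∧ ‖p.2‖ < Real.tan (θ / 2) * p.1} ∩ {p | T ≤ p.1},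
        Real.exp (2 * α * p.1 / Real.sin (θ / 2)))
      / (∫ p in {p : ℝ × EuclideanSpace ℝ (Fin (n - 1)) |
          0 < p.1 ∧ ‖p.2‖ < Real.tan (θ / 2) * p.1},
        Real.exp (2 * α * p.1 / Real.sin (θ / 2)))
    = (1 / Real.Gamma n)
        * ∫ y in Set.Ioi (2 * |α| * T / Real.sin (θ / 2)),
            Real.exp (-y) * y ^ (n - 1) := by
  obtain ⟨d, rfl⟩ : ∃ d, n = d + 1 := ⟨n - 1, by omega⟩
  rw [Nat.add_sub_cancel]
  have hsin : 0 < sin (θ / 2) :=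
    sin_pos_of_pos_of_lt_pi (by linarith [hθ.1]) (by linarith [hθ.1, hθ.2])
  have htan : 0 < tan (θ / 2) :=
    tan_pos_of_pos_of_lt_pi_div_two (by linarith [hθ.1]) (by linarith [hθ.2])
  have hk : 0 < 2 * |α| / sin (θ / 2) := by have := abs_pos.2 hα.ne; positivity
  have hexp : ∀ x : ℝ, 2 * α * x / sin (θ / 2) = -(2 * |α| / sin (θ / 2) * x) := fun x ↦ by
    rw [abs_of_neg hα]; ring
  have hset : {p : ℝ × EuclideanSpace ℝ (Fin d) |
      0 < p.1 ∧ ‖p.2‖ < tan (θ / 2) * p.1} ∩ {p | T ≤ p.1}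
      = {p | p.1 ∈ Set.Ici T ∧ ‖p.2‖ < tan (θ / 2) * p.1} := by
    ext p
    simp only [Set.mem_inter_iff, Set.mem_ofPred_eq, Set.mem_Ici]
    exact ⟨fun h ↦ ⟨h.2, h.1.2⟩, fun h ↦ ⟨⟨hT.trans_le h.1, h.2⟩, h.1⟩⟩
  have hGamma : ∫ y in Set.Ioi (0 : ℝ), rexp (-y) * y ^ d = Gamma ((d + 1 : ℕ) : ℝ) := by
    rw [Gamma_eq_integral (by positivity)]
    simp
  have hball : 0 < volume.real (Metric.ball (0 : EuclideanSpace ℝ (Fin d)) 1) :=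
    ENNReal.toReal_pos (Metric.measure_ball_pos volume _ one_pos).ne' measure_ball_lt_top.ne
  have hΓ : 0 < Gamma ((d + 1 : ℕ) : ℝ) := Gamma_pos_of_pos (by positivity)
  have htail := setIntegral_cone_comp_fst (E := EuclideanSpace ℝ (Fin d))
    measurableSet_Ici (fun x hx ↦ hT.trans_le hx : Set.Ici T ⊆ Set.Ioi 0) htan
    (g := fun x ↦ rexp (-(2 * |α| / sin (θ / 2) * x))) (by fun_prop)
  have hfull := setIntegral_cone_comp_fst (E := EuclideanSpace ℝ (Fin d))
    measurableSet_Ioi (subset_refl (Set.Ioi (0 : ℝ))) htan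
    (g := fun x ↦ rexp (-(2 * |α| / sin (θ / 2) * x))) (by fun_prop)
  simp only [finrank_euclideanSpace_fin] at htail hfull
  rw [integral_Ici_eq_integral_Ioi, integral_Ioi_exp_neg_mul_mul_pow hk] at htail
  rw [integral_Ioi_exp_neg_mul_mul_pow hk, mul_zero, hGamma] at hfull
  simp only [Set.mem_Ioi] at hfull
  simp only [hexp]
  rw [hset, htail, hfull, div_mul_eq_mul_div _ _ T]
  field_simp
end

section
/- Let n ≥ 2 be an integer, let α < 0 be real, and let θ ∈ (0,π). Define φ : ℝ × ℝ^{n−1} → ℝ by φ(x,y) = e^{αx/sin(θ/2)}. Then: (a) φ is smooth and satisfies −Δφ = λ₁·φ everywhere on ℝⁿ with λ₁ = −α²/sin²(θ/2); and (b) for every boundary point (x,y) of the cone C_θ = {(x,y) ∈ (0,∞) × ℝ^{n−1} : |y| < tan(θ/2)·x} with x > 0 and y ≠ 0, the outward unit normal vector ν = (−sin(θ/2), cos(θ/2)·y/|y|) satisfies ⟨∇φ(x,y), ν⟩ + α·φ(x,y) = 0, i.e., φ satisfies the Robin boundary condition ∂_ν φ + αφ = 0 on the lateral boundary of C_θ.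 -/
open Real MeasureTheory
open scoped RealInnerProductSpace

/-- The Euclidean Laplacian of `f : ℝ × ℝⁿ → ℝ` (with the `L²` product inner product
structure) at `p`: the sum of the pure second directional derivatives along the standard
orthonormal basis vectors. -/
noncomputable def euclideanLaplacianProd (n : ℕ)
    (f : WithLp 2 (ℝ × EuclideanSpace ℝ (Fin n)) → ℝ)
    (p : WithLp 2 (ℝ × EuclideanSpace ℝ (Fin n))) : ℝ :=
  iteratedFDeriv ℝ 2 f p
      ![(WithLp.equiv 2 (ℝ × EuclideanSpace ℝ (Fin n))).symm (1, 0),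
        (WithLp.equiv 2 (ℝ × EuclideanSpace ℝ (Fin n))).symm (1, 0)]
    + ∑ i : Fin n, iteratedFDeriv ℝ 2 f p
        ![(WithLp.equiv 2 (ℝ × EuclideanSpace ℝ (Fin n))).symm (0, EuclideanSpace.single i 1),
          (WithLp.equiv 2 (ℝ × EuclideanSpace ℝ (Fin n))).symm (0, EuclideanSpace.single i 1)]

section ExpLinear

variable {E : Type*} [NormedAddCommGroup E]

/-- The Fréchet derivative of the exponential of a continuous linear functional. -/
theorem hasFDerivAt_exp_clm [NormedSpace ℝ E] (L : E →L[ℝ] ℝ) (p : E) :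
    HasFDerivAt (fun q => Real.exp (L q)) (Real.exp (L p) • L) p :=
  L.hasFDerivAt.exp

/-- The second derivative of the exponential of a continuous linear functional. -/
theorem iteratedFDeriv_two_exp_clm [NormedSpace ℝ E] (L : E →L[ℝ] ℝ) (p u v : E) :
    iteratedFDeriv ℝ 2 (fun q => Real.exp (L q)) p ![u, v] = Real.exp (L p) * L u * L v := by
  have h : fderiv ℝ (fun q => Real.exp (L q)) = fun q => Real.exp (L q) • L :=
    funext fun q => (hasFDerivAt_exp_clm L q).fderiv
  rw [iteratedFDeriv_two_apply, h, ((hasFDerivAt_exp_clm L p).smul_const L).fderiv]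
  simp

theorem inner_gradient_exp_clm [InnerProductSpace ℝ E] [CompleteSpace E] (L : E →L[ℝ] ℝ)
    (p v : E) :
    ⟪gradient (fun q => Real.exp (L q)) p, v⟫ = Real.exp (L p) * L v := by
  rw [gradient, InnerProductSpace.toDual_symm_apply, (hasFDerivAt_exp_clm L p).fderiv]
  simp

end ExpLinear

/-- Let `n ≥ 2`, `α < 0`, `θ ∈ (0,π)`, and `φ(x,y) = e^{αx/sin(θ/2)}` on `ℝⁿ = ℝ × ℝ^{n−1}`.
Then (a) `φ` is smooth and `−Δφ = λ₁ φ` on all of `ℝⁿ` with `λ₁ = −α²/sin²(θ/2)`; and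
(b) at every lateral boundary point `(x,y)` of the cone `C_θ` with `x > 0` and `y ≠ 0`
(i.e. `‖y‖ = tan(θ/2) x`), the outward unit normal `ν = (−sin(θ/2), cos(θ/2) y/‖y‖)`
satisfies `⟨∇φ(x,y), ν⟩ + α φ(x,y) = 0`. -/
theorem cone_ground_state_robin (n : ℕ) (hn : 2 ≤ n) (α : ℝ) (hα : α < 0)
    (θ : ℝ) (hθ : θ ∈ Set.Ioo 0 π) :
    (ContDiff ℝ (⊤ : ℕ∞) (fun p : WithLp 2 (ℝ × EuclideanSpace ℝ (Fin (n - 1))) =>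
        Real.exp (α * ((WithLp.equiv 2 (ℝ × EuclideanSpace ℝ (Fin (n - 1)))) p).1
          / Real.sin (θ / 2))) ∧
      ∀ p : WithLp 2 (ℝ × EuclideanSpace ℝ (Fin (n - 1))),
        -(euclideanLaplacianProd (n - 1)
            (fun q => Real.exp (α * ((WithLp.equiv 2 (ℝ × EuclideanSpace ℝ (Fin (n - 1)))) q).1
              / Real.sin (θ / 2))) p)
          = (-(α ^ 2) / Real.sin (θ / 2) ^ 2)
              * Real.exp (α * ((WithLp.equiv 2 (ℝ × EuclideanSpace ℝ (Fin (n - 1)))) p).1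
                  / Real.sin (θ / 2))) ∧
    (∀ p : WithLp 2 (ℝ × EuclideanSpace ℝ (Fin (n - 1))),
      0 < ((WithLp.equiv 2 (ℝ × EuclideanSpace ℝ (Fin (n - 1)))) p).1 →
      ((WithLp.equiv 2 (ℝ × EuclideanSpace ℝ (Fin (n - 1)))) p).2 ≠ 0 →
      ‖((WithLp.equiv 2 (ℝ × EuclideanSpace ℝ (Fin (n - 1)))) p).2‖
        = Real.tan (θ / 2) * ((WithLp.equiv 2 (ℝ × EuclideanSpace ℝ (Fin (n - 1)))) p).1 →
      ⟪gradient (fun q : WithLp 2 (ℝ × EuclideanSpace ℝ (Fin (n - 1))) =>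
            Real.exp (α * ((WithLp.equiv 2 (ℝ × EuclideanSpace ℝ (Fin (n - 1)))) q).1
              / Real.sin (θ / 2))) p,
          (WithLp.equiv 2 (ℝ × EuclideanSpace ℝ (Fin (n - 1)))).symm
            (-Real.sin (θ / 2),
              Real.cos (θ / 2) •
                ‖((WithLp.equiv 2 (ℝ × EuclideanSpace ℝ (Fin (n - 1)))) p).2‖⁻¹ •
                  ((WithLp.equiv 2 (ℝ × EuclideanSpace ℝ (Fin (n - 1)))) p).2)⟫
        + α * Real.exp (α * ((WithLp.equiv 2 (ℝ × EuclideanSpace ℝ (Fin (n - 1)))) p).1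
            / Real.sin (θ / 2)) = 0) := by
  have hs : Real.sin (θ / 2) ≠ 0 :=
    (Real.sin_pos_of_pos_of_lt_pi (by linarith [hθ.1]) (by linarith [hθ.1, hθ.2])).ne'
  let L : WithLp 2 (ℝ × EuclideanSpace ℝ (Fin (n - 1))) →L[ℝ] ℝ :=
    (α / Real.sin (θ / 2)) • WithLp.fstL 2 ℝ ℝ (EuclideanSpace ℝ (Fin (n - 1)))
  have hL (p) : α * ((WithLp.equiv 2 (ℝ × EuclideanSpace ℝ (Fin (n - 1)))) p).1
      / Real.sin (θ / 2) = L p :=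
    mul_div_right_comm _ _ _
  have hLsymm (x y) : L ((WithLp.equiv 2 (ℝ × EuclideanSpace ℝ (Fin (n - 1)))).symm (x, y))
      = α / Real.sin (θ / 2) * x := rfl
  simp only [hL]
  refine ⟨⟨L.contDiff.exp, fun p => ?_⟩, fun p _ _ _ => ?_⟩
  · simp only [euclideanLaplacianProd, iteratedFDeriv_two_exp_clm, hLsymm]
    simp only [mul_zero, Finset.sum_const_zero]
    ring
  · rw [inner_gradient_exp_clm, hLsymm]
    field_simp
    ring
end
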